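/- Generalized Fuglede formula (case k ≥ m): if f is locally integrable on M_{n,m} with ∫∫ |f(x + γ[u;0])| du dγ < ∞, and k ≥ m, then c·(f̂)ˇ(x) = (I^k f)(x), where (I^k f)(x) = γ_{n,m}(k)^{-1} ∫_{M_{n,m}} f(x-y) det(y'y)^{(k-n)/2} dy, c = 2^{-km} π^{-km/2} Γ_m((n-k)/2)/Γ_m(n/2), and γ_{n,m}(α) = 2^{αm} π^{nm/2} Γ_m(α/2)/Γ_m((n-α)/2). -/

import Mathlib

open MeasureTheory Matrix

noncomputable instance matMeasureSpace {α β : Type*} [Fintype α] [Fintype β] :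
    MeasureSpace (Matrix α β ℝ) :=
  inferInstanceAs (MeasureSpace (α → β → ℝ))

/-- The distinguished frame `ξ₀ = [0; I_{n-k}] ∈ V_{n,n-k}`, with `n = k + l`
realized through the index type `Fin k ⊕ Fin l`. -/
def xi0 (k l : ℕ) : Matrix (Fin k ⊕ Fin l) (Fin l) ℝ := Matrix.fromRows 0 1

/-- The real Siegel gamma function `Γ_m(a) = π^{m(m-1)/4} ∏_{j=0}^{m-1} Γ(a - j/2)`. -/
noncomputable def SiegelGammaR (m : ℕ) (a : ℝ) : ℝ :=
  Real.pi ^ (((m * (m - 1) : ℕ) : ℝ) / 4) *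
    ∏ j ∈ Finset.range m, Real.Gamma (a - (j : ℝ) / 2)

set_option linter.unusedSectionVars false

open scoped ENNReal

namespace Fuglede

section inst
variable {ι κ : Type*} [Fintype ι] [Fintype κ]

instance instBorelMat : BorelSpace (Matrix ι κ ℝ) := inferInstanceAs (BorelSpace (ι → κ → ℝ))

instance instSCMat : SecondCountableTopology (Matrix ι κ ℝ) :=
  inferInstanceAs (SecondCountableTopology (ι → κ → ℝ))

instance instSigmaMat : SigmaFinite (volume : Measure (Matrix ι κ ℝ)) :=
  inferInstanceAs (SigmaFinite (volume : Measure (ι → κ → ℝ)))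

instance instHaarPi : Measure.IsAddHaarMeasure (volume : Measure (ι → κ → ℝ)) :=
  MeasureTheory.Measure.instIsAddHaarMeasureForallVolumeOfMeasurableAddOfSigmaFinite

instance instHaarMat : Measure.IsAddHaarMeasure (volume : Measure (Matrix ι κ ℝ)) :=
  instHaarPi

instance instLCMat : LocallyCompactSpace (Matrix ι κ ℝ) :=
  inferInstanceAs (LocallyCompactSpace (ι → κ → ℝ))

end inst

section cov
variable {ι κ : Type*} [Fintype ι] [Fintype κ] [DecidableEq ι] [DecidableEq κ]

lemma map_linear (T : Matrix ι κ ℝ →ₗ[ℝ] Matrix ι κ ℝ) (hT : LinearMap.det T ≠ 0) :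
    Measure.map T (volume : Measure (Matrix ι κ ℝ)) =
      ENNReal.ofReal |(LinearMap.det T)⁻¹| • volume :=
  Measure.map_linearMap_addHaar_eq_smul_addHaar (E := ι → κ → ℝ) volume hT

lemma det_mulRight (g : Matrix κ κ ℝ) :
    LinearMap.det (mulRightLinearMap ι ℝ g) = g.det ^ (Fintype.card ι) := by
  have h := LinearMap.det_pi (R := ℝ) (fun _ : ι => Matrix.toLin' gᵀ)
  simp only [LinearMap.det_toLin', Matrix.det_transpose, Finset.prod_const, Finset.card_univ] at h
  rw [← h]
  congr 1
  ext y i j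
  change (y * g) i j = (gᵀ *ᵥ (y i)) j
  simp [Matrix.mul_apply, Matrix.mulVec, dotProduct, mul_comm]

lemma det_mulLeft (g : Matrix ι ι ℝ) :
    LinearMap.det (mulLeftLinearMap κ ℝ g) = g.det ^ (Fintype.card κ) := by
  have h := det_mulRight (ι := κ) gᵀ
  rw [Matrix.det_transpose] at h
  rw [← h, ← LinearMap.det_conj _ (Matrix.transposeLinearEquiv κ ι ℝ ℝ)]
  congr 1
  ext y i j
  simp [Matrix.mul_apply, mul_comm]

lemma lint_mul_right (g : Matrix κ κ ℝ) (hg : g.det ≠ 0) (F : Matrix ι κ ℝ → ℝ≥0∞)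
    (hF : Measurable F) :
    ENNReal.ofReal (|g.det| ^ (Fintype.card ι)) * ∫⁻ y : Matrix ι κ ℝ, F (y * g) = ∫⁻ y, F y := by
  have hd : LinearMap.det (mulRightLinearMap ι ℝ g) ≠ 0 := by
    rw [det_mulRight]; positivity
  have h := map_linear _ hd
  have hm : Measurable (mulRightLinearMap ι ℝ g) :=
    (by fun_prop : Continuous fun y : Matrix ι κ ℝ => y * g).measurable
  have h2 : ∫⁻ y : Matrix ι κ ℝ, F (y * g) = ∫⁻ y, F y ∂(Measure.map (mulRightLinearMap ι ℝ g) volume) := by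
    rw [lintegral_map hF hm]; rfl
  rw [h2, h, lintegral_smul_measure, smul_eq_mul, ← mul_assoc, ← ENNReal.ofReal_mul (by positivity),
    det_mulRight, abs_inv, abs_pow, mul_inv_cancel₀ (by positivity)]
  simp

lemma lint_mul_left (g : Matrix ι ι ℝ) (hg : g.det ≠ 0) (F : Matrix ι κ ℝ → ℝ≥0∞)
    (hF : Measurable F) :
    ENNReal.ofReal (|g.det| ^ (Fintype.card κ)) * ∫⁻ y : Matrix ι κ ℝ, F (g * y) = ∫⁻ y, F y := by
  have hd : LinearMap.det (mulLeftLinearMap κ ℝ g) ≠ 0 := by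
    rw [det_mulLeft]; positivity
  have h := map_linear _ hd
  have hm : Measurable (mulLeftLinearMap κ ℝ g) :=
    (by fun_prop : Continuous fun y : Matrix ι κ ℝ => g * y).measurable
  have h2 : ∫⁻ y : Matrix ι κ ℝ, F (g * y) = ∫⁻ y, F y ∂(Measure.map (mulLeftLinearMap κ ℝ g) volume) := by
    rw [lintegral_map hF hm]; rfl
  rw [h2, h, lintegral_smul_measure, smul_eq_mul, ← mul_assoc, ← ENNReal.ofReal_mul (by positivity),
    det_mulLeft, abs_inv, abs_pow, mul_inv_cancel₀ (by positivity)]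
  simp

/-- The Gram determinant is almost everywhere nonzero. -/
lemma ae_gram_ne_zero (P : Matrix ι κ ℝ) (hP : Pᵀ * P = 1) :
    ∀ᵐ y : Matrix ι κ ℝ, (yᵀ * y).det ≠ 0 := by
  set Z : Set (Matrix ι κ ℝ) := {y | (yᵀ * y).det = 0} with hZ
  have hcont : Continuous fun y : Matrix ι κ ℝ => (yᵀ * y).det := by fun_prop
  have hZm : MeasurableSet Z := (isClosed_singleton.preimage hcont).measurableSet
  have hfin : ∀ y : Matrix ι κ ℝ, Set.Finite {t : ℝ | t • P + y ∈ Z} := by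
    intro y
    have hsub : {t : ℝ | t • P + y ∈ Z} ⊆ {t | (-(Pᵀ * y)).charpoly.IsRoot t} := by
      intro t ht
      have ht' : ((t • P + y)ᵀ * (t • P + y)).det = 0 := ht
      obtain ⟨v, hv, hv0⟩ := Matrix.exists_mulVec_eq_zero_iff.2 ht'
      have h0 : (t • P + y) *ᵥ v = 0 := by
        rw [← Matrix.mulVec_mulVec] at hv0
        have h1 : v ⬝ᵥ ((t • P + y)ᵀ *ᵥ ((t • P + y) *ᵥ v)) = 0 := by rw [hv0]; simp
        rw [Matrix.dotProduct_mulVec, Matrix.vecMul_transpose] at h1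
        exact dotProduct_self_eq_zero.1 h1
      have h2 : (Pᵀ * (t • P + y)).det = 0 := by
        apply Matrix.exists_mulVec_eq_zero_iff.1
        exact ⟨v, hv, by rw [← Matrix.mulVec_mulVec, h0]; simp⟩
      simp only [Set.mem_ofPred_eq, Polynomial.IsRoot, Matrix.eval_charpoly]
      rw [← h2]
      congr 1
      rw [Matrix.mul_add, Matrix.mul_smul, hP, sub_neg_eq_add, Matrix.scalar_apply,
        Matrix.smul_one_eq_diagonal]
    refine Set.Finite.subset ?_ hsub
    exact Polynomial.finite_setOfPred_isRoot (Matrix.charpoly_monic _).ne_zero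
  have hW : MeasurableSet {p : ℝ × Matrix ι κ ℝ | p.1 • P + p.2 ∈ Z} := by
    apply hZm.preimage
    exact (by fun_prop : Continuous fun p : ℝ × Matrix ι κ ℝ => p.1 • P + p.2).measurable
  have h1 : (volume : Measure ℝ).prod (volume : Measure (Matrix ι κ ℝ))
      {p : ℝ × Matrix ι κ ℝ | p.1 • P + p.2 ∈ Z} = 0 := by
    rw [Measure.prod_apply_symm hW]
    rw [lintegral_eq_zero_iff' (by exact (measurable_measure_prodMk_right hW).aemeasurable)]
    filter_upwards with y
    exact (hfin y).measure_zero _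
  rw [Measure.prod_apply hW, lintegral_eq_zero_iff' (by exact (measurable_measure_prodMk_left hW).aemeasurable)] at h1
  obtain ⟨t, ht⟩ := h1.exists
  rw [ae_iff]
  simp only [not_not]
  have : (volume : Measure (Matrix ι κ ℝ)) ((fun y => t • P + y) ⁻¹' Z) = 0 := ht
  rwa [measure_preimage_add] at this

end cov

section weights
variable {ι κ : Type*} [Fintype ι] [Fintype κ] [DecidableEq ι] [DecidableEq κ]

lemma exists_sqrt (y : Matrix ι κ ℝ) : ∃ s : Matrix κ κ ℝ, sᵀ * s = yᵀ * y := by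
  have h : (yᵀ * y).PosSemidef := by
    simpa using Matrix.posSemidef_conjTranspose_mul_self y
  open scoped MatrixOrder in
  obtain ⟨s, hs⟩ := CStarAlgebra.nonneg_iff_eq_star_mul_self.1 h.nonneg
  refine ⟨s, ?_⟩
  rw [hs]
  simp [Matrix.star_eq_conjTranspose]

/-- `w p y = |y|_m ^ p`. -/
noncomputable def w (p : ℝ) (y : Matrix ι κ ℝ) : ℝ≥0∞ :=
  ENNReal.ofReal (Real.sqrt ((yᵀ * y).det) ^ p)

lemma w_measurable (p : ℝ) : Measurable (w p : Matrix ι κ ℝ → ℝ≥0∞) := by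
  have hcont : Continuous fun y : Matrix ι κ ℝ => √(yᵀ * y).det := by fun_prop
  unfold w
  exact (hcont.measurable.pow_const p).ennreal_ofReal

lemma gram_nonneg (y : Matrix ι κ ℝ) : 0 ≤ (yᵀ * y).det := by
  have h : (yᵀ * y).PosSemidef := by
    simpa using Matrix.posSemidef_conjTranspose_mul_self y
  exact h.det_nonneg

lemma w_mul (p q : ℝ) (y : Matrix ι κ ℝ) (hy : (yᵀ * y).det ≠ 0) :
    w p y * w q y = w (p + q) y := by
  have h : 0 < √(yᵀ * y).det := Real.sqrt_pos.2 (lt_of_le_of_ne (gram_nonneg y) hy.symm)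
  unfold w
  rw [← ENNReal.ofReal_mul (by positivity), Real.rpow_add h]

lemma w_zero (y : Matrix ι κ ℝ) : w 0 y = 1 := by simp [w]

lemma w_congr {ι' : Type*} [Fintype ι'] (p : ℝ) (y : Matrix ι κ ℝ) (z : Matrix ι' κ ℝ)
    (h : yᵀ * y = zᵀ * z) : w p y = w p z := by simp [w, h]

lemma w_comp_mul (p : ℝ) (y : Matrix ι κ ℝ) (g : Matrix κ κ ℝ) :
    w p (y * g) = w p y * w p g := by
  unfold w
  rw [← ENNReal.ofReal_mul (by positivity), ← Real.mul_rpow (by positivity) (by positivity),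
    ← Real.sqrt_mul (gram_nonneg y)]
  congr 3
  rw [Matrix.transpose_mul, Matrix.mul_assoc, ← Matrix.mul_assoc yᵀ, Matrix.det_mul, Matrix.det_mul,
    Matrix.det_mul]
  ring

lemma w_nat (q : ℕ) (g : Matrix κ κ ℝ) : ENNReal.ofReal (|g.det| ^ q) = w q g := by
  unfold w
  rw [Matrix.det_mul, Matrix.det_transpose, Real.sqrt_mul_self_eq_abs, Real.rpow_natCast]

lemma gram_sq_ne {g : Matrix κ κ ℝ} : (gᵀ * g).det ≠ 0 ↔ g.det ≠ 0 := by
  simp [Matrix.det_mul]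

lemma w_ne_top (p : ℝ) (y : Matrix ι κ ℝ) : w p y ≠ ⊤ := ENNReal.ofReal_ne_top

lemma w_inv_mul (p : ℝ) (y : Matrix ι κ ℝ) (hy : (yᵀ * y).det ≠ 0) : w (-p) y * w p y = 1 := by
  rw [w_mul _ _ _ hy]; simp [w_zero]

/-- Gaussian weight of a Gram matrix. -/
noncomputable def ge (r : Matrix κ κ ℝ) : ℝ≥0∞ := ENNReal.ofReal (Real.exp (-r.trace))

lemma ge_ne_top (r : Matrix κ κ ℝ) : ge r ≠ ⊤ := ENNReal.ofReal_ne_top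

lemma ge_measurable : Measurable (ge : Matrix κ κ ℝ → ℝ≥0∞) := by
  have hcont : Continuous fun y : Matrix κ κ ℝ => Real.exp (-y.trace) := by fun_prop
  exact hcont.measurable.ennreal_ofReal

lemma measurable_gram : Measurable fun y : Matrix ι κ ℝ => yᵀ * y :=
  (by fun_prop : Continuous fun y : Matrix ι κ ℝ => yᵀ * y).measurable

lemma measurable_mul2 {κ' : Type*} [Fintype κ'] :
    Measurable fun p : Matrix ι κ ℝ × Matrix κ κ' ℝ => p.1 * p.2 :=
  (by fun_prop : Continuous fun p : Matrix ι κ ℝ × Matrix κ κ' ℝ => p.1 * p.2).measurable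

lemma measurable_inv_mat : Measurable fun g : Matrix κ κ ℝ => g⁻¹ := by
  have h1 : Continuous fun g : Matrix κ κ ℝ => g.adjugate := by fun_prop
  have h2 : Continuous fun g : Matrix κ κ ℝ => g.det := by fun_prop
  have h : (fun g : Matrix κ κ ℝ => g⁻¹) = fun g => (g.det)⁻¹ • g.adjugate := by
    funext g
    rw [Matrix.inv_def, Ring.inverse_eq_inv']
  rw [h]
  have h3 : Continuous fun p : ℝ × Matrix κ κ ℝ => p.1 • p.2 := by fun_prop
  exact h3.measurable.comp ((h2.measurable.inv).prodMk h1.measurable)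

/-- The constant `K`. -/
noncomputable def Kc (κ : Type*) [Fintype κ] [DecidableEq κ] (k : ℝ) : ℝ≥0∞ :=
  ∫⁻ g : Matrix κ κ ℝ, ge ((g⁻¹)ᵀ * g⁻¹) * w (-k - Fintype.card κ) g

/-- The functional `α`. -/
noncomputable def al (ι : Type*) {κ : Type*} [Fintype ι] [Fintype κ] [DecidableEq κ] (k : ℝ)
    (φ : Matrix κ κ ℝ → ℝ≥0∞) : ℝ≥0∞ :=
  ∫⁻ y : Matrix ι κ ℝ, φ (yᵀ * y) * w (k - Fintype.card ι) y

lemma claim1 (k : ℝ) (φ : Matrix κ κ ℝ → ℝ≥0∞) (hφ : Measurable fun g : Matrix κ κ ℝ => φ (gᵀ * g))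
    (y : Matrix ι κ ℝ) (hy : (yᵀ * y).det ≠ 0) :
    w k y * ∫⁻ g : Matrix κ κ ℝ, φ ((y * g)ᵀ * (y * g)) * w (k - Fintype.card κ) g = al κ k φ := by
  obtain ⟨s, hs⟩ := exists_sqrt y
  have hsd : (sᵀ * s).det ≠ 0 := by rwa [hs]
  have hsg : ∀ g : Matrix κ κ ℝ, (y * g)ᵀ * (y * g) = (s * g)ᵀ * (s * g) := by
    intro g
    rw [Matrix.transpose_mul, Matrix.mul_assoc, ← Matrix.mul_assoc yᵀ, ← hs, Matrix.transpose_mul]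
    simp only [Matrix.mul_assoc]
  simp_rw [hsg]
  rw [← w_congr k s y hs]
  have hH : Measurable fun h : Matrix κ κ ℝ => φ (hᵀ * h) * w (k - Fintype.card κ) h :=
    hφ.mul (w_measurable _)
  have := lint_mul_left s (gram_sq_ne.1 hsd) _ hH
  rw [w_nat] at this
  rw [al, ← this]
  have hk : k = Fintype.card κ + (k - Fintype.card κ) := by ring
  conv_lhs => rw [hk, ← w_mul _ _ _ hsd]
  rw [mul_assoc, ← lintegral_const_mul' _ _ (w_ne_top _ _)]
  congr 2
  funext g
  rw [w_comp_mul]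
  have : (Fintype.card κ + (k - Fintype.card κ) : ℝ) - Fintype.card κ = k - Fintype.card κ := by ring
  rw [this]
  ring

lemma claim2 (k : ℝ) (z : Matrix ι κ ℝ) (hz : (zᵀ * z).det ≠ 0) :
    w k z * ∫⁻ g : Matrix κ κ ℝ, ge ((z * g⁻¹)ᵀ * (z * g⁻¹)) * w (-k - Fintype.card κ) g =
      Kc κ k := by
  obtain ⟨s, hs⟩ := exists_sqrt z
  have hsd : (sᵀ * s).det ≠ 0 := by rwa [hs]
  have hsg : ∀ g : Matrix κ κ ℝ, (z * g)ᵀ * (z * g) = (s * g)ᵀ * (s * g) := by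
    intro g
    rw [Matrix.transpose_mul, Matrix.mul_assoc, ← Matrix.mul_assoc zᵀ, ← hs, Matrix.transpose_mul]
    simp only [Matrix.mul_assoc]
  simp_rw [hsg]
  rw [← w_congr k s z hs]
  have hH : Measurable fun g : Matrix κ κ ℝ =>
      ge ((s * g⁻¹)ᵀ * (s * g⁻¹)) * w (-k - Fintype.card κ) g := by
    refine Measurable.mul ?_ (w_measurable _)
    have hc : Continuous fun g : Matrix κ κ ℝ => (s * g)ᵀ * (s * g) := by fun_prop
    exact ge_measurable.comp (hc.measurable.comp measurable_inv_mat)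
  have := lint_mul_right s (gram_sq_ne.1 hsd) _ hH
  rw [w_nat] at this
  rw [← this, Kc]
  have hss : ∀ h : Matrix κ κ ℝ, s * (h * s)⁻¹ = h⁻¹ := by
    intro h
    rw [Matrix.mul_inv_rev, ← Matrix.mul_assoc, Matrix.mul_nonsing_inv _
      (isUnit_iff_ne_zero.2 (gram_sq_ne.1 hsd)), Matrix.one_mul]
  simp_rw [hss, w_comp_mul]
  rw [← mul_assoc, w_mul _ _ _ hsd, ← lintegral_const_mul' _ _ (w_ne_top _ _)]
  congr 1
  funext g
  have h1 : w (k + Fintype.card κ) s * w (-k - Fintype.card κ) s = 1 := by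
    rw [w_mul _ _ _ hsd]; ring_nf; exact w_zero _
  rw [mul_comm (w (-k - (Fintype.card κ : ℝ)) g), ← mul_assoc, mul_left_comm, ]
  calc _ = (w (k + Fintype.card κ) s * w (-k - Fintype.card κ) s) *
      (ge (g⁻¹ᵀ * g⁻¹) * w (-k - Fintype.card κ) g) := by ring
    _ = _ := by rw [h1, one_mul]

theorem key (k : ℝ) (P : Matrix ι κ ℝ) (hP : Pᵀ * P = 1)
    (φ : Matrix κ κ ℝ → ℝ≥0∞) (hφ : Measurable fun g : Matrix κ κ ℝ => φ (gᵀ * g))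
    (hφ' : Measurable fun y : Matrix ι κ ℝ => φ (yᵀ * y)) :
    Kc κ k * al ι k φ = al κ k φ * al ι k (ge (κ := κ)) := by
  have hae := ae_gram_ne_zero P hP
  have hae' : ∀ᵐ g : Matrix κ κ ℝ, (gᵀ * g).det ≠ 0 := ae_gram_ne_zero (1 : Matrix κ κ ℝ) (by simp)
  set n := ((Fintype.card ι : ℕ) : ℝ) with hn
  set m := ((Fintype.card κ : ℕ) : ℝ) with hm
  have hinv2 : Measurable fun p : Matrix ι κ ℝ × Matrix κ κ ℝ => p.1 * p.2⁻¹ :=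
    (measurable_mul2 (ι := ι) (κ := κ) (κ' := κ)).comp (measurable_fst.prodMk (measurable_inv_mat.comp measurable_snd))
  have e1 : ∫⁻ y : Matrix ι κ ℝ, ∫⁻ g : Matrix κ κ ℝ,
      φ ((y * g)ᵀ * (y * g)) * ge (yᵀ * y) * w (2 * k - n) y * w (k - m) g =
      al κ k φ * al ι k (ge (κ := κ)) := by
    unfold al
    have hM1 : Measurable fun y : Matrix ι κ ℝ => ge (yᵀ * y) * w (k - Fintype.card ι) y :=
      (ge_measurable.comp (measurable_gram (ι := ι) (κ := κ))).mul (w_measurable _)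
    rw [← lintegral_const_mul _ hM1]
    apply lintegral_congr_ae
    filter_upwards [hae] with y hy
    have h := claim1 k φ hφ y hy
    unfold al at h
    rw [← h, ← lintegral_const_mul' _ _ (w_ne_top _ _),
      ← lintegral_mul_const' _ _ (ENNReal.mul_ne_top (ge_ne_top (yᵀ * y)) (w_ne_top _ _))]
    apply lintegral_congr
    intro g
    have : w (2 * k - n) y = w k y * w (k - n) y := by rw [w_mul _ _ _ hy]; congr 1; ring
    rw [this]
    ring
  have e2 : ∫⁻ g : Matrix κ κ ℝ, ∫⁻ y : Matrix ι κ ℝ,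
      φ ((y * g)ᵀ * (y * g)) * ge (yᵀ * y) * w (2 * k - n) y * w (k - m) g =
      ∫⁻ g : Matrix κ κ ℝ, ∫⁻ z : Matrix ι κ ℝ,
      φ (zᵀ * z) * ge ((z * g⁻¹)ᵀ * (z * g⁻¹)) * w (2 * k - n) z * w (-k - m) g := by
    apply lintegral_congr_ae
    filter_upwards [hae'] with g hg
    have hG : Measurable fun z : Matrix ι κ ℝ =>
      φ (zᵀ * z) * ge ((z * g⁻¹)ᵀ * (z * g⁻¹)) * w (2 * k - n) z * w (-k - m) g := by
      refine ((hφ'.mul ?_).mul (w_measurable _)).mul_const _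
      have hc : Continuous fun z : Matrix ι κ ℝ => (z * g⁻¹)ᵀ * (z * g⁻¹) := by fun_prop
      exact ge_measurable.comp hc.measurable
    have h := lint_mul_right g (gram_sq_ne.1 hg) _ hG
    rw [← h, w_nat, ← lintegral_const_mul' _ _ (w_ne_top _ _)]
    apply lintegral_congr
    intro y
    rw [Matrix.mul_assoc y g, Matrix.mul_nonsing_inv _ (isUnit_iff_ne_zero.2 (gram_sq_ne.1 hg)),
      Matrix.mul_one, w_comp_mul]
    have : w (k - m) g = w n g * w (2 * k - n) g * w (-k - m) g := by
      rw [w_mul _ _ _ hg, w_mul _ _ _ hg]; congr 1; ring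
    rw [this]
    ring
  have e3 : ∫⁻ z : Matrix ι κ ℝ, ∫⁻ g : Matrix κ κ ℝ,
      φ (zᵀ * z) * ge ((z * g⁻¹)ᵀ * (z * g⁻¹)) * w (2 * k - n) z * w (-k - m) g =
      Kc κ k * al ι k φ := by
    unfold al
    have hM1 : Measurable fun y : Matrix ι κ ℝ => φ (yᵀ * y) * w (k - Fintype.card ι) y :=
      hφ'.mul (w_measurable _)
    rw [← lintegral_const_mul _ hM1]
    apply lintegral_congr_ae
    filter_upwards [hae] with z hz
    have h := claim2 k z hz
    have : w (2 * k - n) z = w k z * w (k - n) z := by rw [w_mul _ _ _ hz]; congr 1; ring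
    rw [← h, this]
    have hM : Measurable fun g : Matrix κ κ ℝ =>
        ge ((z * g⁻¹)ᵀ * (z * g⁻¹)) * w (-k - m) g := by
      refine Measurable.mul ?_ (w_measurable _)
      have hc : Continuous fun g : Matrix κ κ ℝ => (z * g)ᵀ * (z * g) := by fun_prop
      exact ge_measurable.comp (hc.measurable.comp measurable_inv_mat)
    rw [← lintegral_const_mul _ hM, ← lintegral_mul_const _ (hM.const_mul _)]
    apply lintegral_congr
    intro g
    ring
  rw [← e1, ← e3]
  refine Eq.trans ?_ (Eq.trans e2.symm ?_)
  · apply lintegral_lintegral_swap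
    refine Measurable.aemeasurable ?_
    refine Measurable.fun_mul (Measurable.fun_mul (Measurable.fun_mul ?_ ?_) ?_) ?_
    · exact hφ'.comp measurable_fst
    · exact ge_measurable.comp ((measurable_gram (ι := ι) (κ := κ)).comp hinv2)
    · exact (w_measurable _).comp measurable_fst
    · exact (w_measurable _).comp measurable_snd
  · apply lintegral_lintegral_swap
    refine Measurable.aemeasurable ?_
    have hsw : Measurable fun p : Matrix κ κ ℝ × Matrix ι κ ℝ => p.2 * p.1 :=
      (measurable_mul2 (ι := ι) (κ := κ) (κ' := κ)).comp measurable_swap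
    refine Measurable.fun_mul (Measurable.fun_mul (Measurable.fun_mul ?_ ?_) ?_) ?_
    · exact hφ'.comp hsw
    · exact ge_measurable.comp ((measurable_gram (ι := ι) (κ := κ)).comp measurable_snd)
    · exact (w_measurable _).comp measurable_snd
    · exact (w_measurable _).comp measurable_fst

end weights

section gauss
variable {ι κ : Type*} [Fintype ι] [Fintype κ] [DecidableEq ι] [DecidableEq κ]

lemma ge_gram (y : Matrix ι κ ℝ) :
    ge (yᵀ * y) = ENNReal.ofReal (∏ i, ∏ j, Real.exp (-(y i j) ^ 2)) := by
  unfold ge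
  congr 1
  simp_rw [← Real.exp_sum]
  congr 1
  simp only [Matrix.trace, Matrix.diag_apply, Matrix.mul_apply, Matrix.transpose_apply,
    Finset.sum_neg_distrib]
  rw [Finset.sum_comm]
  simp [pow_two]

lemma gauss_lint : ∫⁻ y : Matrix ι κ ℝ, ge (yᵀ * y) =
    ENNReal.ofReal (Real.pi ^ ((Fintype.card ι * Fintype.card κ : ℝ) / 2)) := by
  simp_rw [ge_gram]
  have hi : Integrable (fun x : ℝ => Real.exp (-x ^ 2)) := by
    simpa using integrable_exp_neg_mul_sq (b := 1) one_pos
  have hi2 : Integrable (fun v : κ → ℝ => ∏ j, Real.exp (-(v j) ^ 2)) :=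
    Integrable.fintype_prod (f := fun _ x => Real.exp (-x ^ 2)) (fun _ => hi)
  have hi3 : Integrable (fun y : ι → κ → ℝ => ∏ i, ∏ j, Real.exp (-(y i j) ^ 2)) :=
    Integrable.fintype_prod (f := fun _ (v : κ → ℝ) => ∏ j, Real.exp (-(v j) ^ 2)) (fun _ => hi2)
  have h := ofReal_integral_eq_lintegral_ofReal hi3
    (Filter.Eventually.of_forall fun y => by positivity)
  refine h.symm.trans ?_
  congr 1
  rw [integral_fintype_prod_volume_eq_pow (fun v : κ → ℝ => ∏ j, Real.exp (-(v j) ^ 2)),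
    integral_fintype_prod_volume_eq_pow (fun x : ℝ => Real.exp (-x ^ 2))]
  have h1 : ∫ x : ℝ, Real.exp (-x ^ 2) = √Real.pi := by
    simpa using integral_gaussian 1
  rw [h1, Real.sqrt_eq_rpow, ← pow_mul, ← Real.rpow_natCast, ← Real.rpow_mul Real.pi_pos.le]
  congr 1
  push_cast
  ring

lemma gamma_lint {a r : ℝ} (ha : 0 < a) (hr : 0 < r) :
    ∫⁻ t in Set.Ioi (0 : ℝ), ENNReal.ofReal (t ^ (a - 1) * Real.exp (-(r * t))) =
      ENNReal.ofReal ((1 / r) ^ a * Real.Gamma a) := by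
  have h := Real.integral_rpow_mul_exp_neg_mul_Ioi ha hr
  have hpos : 0 < (1 / r) ^ a * Real.Gamma a := by
    have := Real.Gamma_pos_of_pos ha
    positivity
  have hi : Integrable (fun t : ℝ => t ^ (a - 1) * Real.exp (-(r * t)))
      (volume.restrict (Set.Ioi 0)) := by
    by_contra hc
    rw [integral_undef hc] at h
    linarith
  rw [← h, ofReal_integral_eq_lintegral_ofReal hi]
  filter_upwards [ae_restrict_mem measurableSet_Ioi] with t ht
  have : 0 < t := ht
  positivity

lemma claim3 (y : Matrix ι κ ℝ) (hy : (yᵀ * y).det ≠ 0) :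
    w 1 y * ∫⁻ v : Matrix κ Unit ℝ, ge ((y * v)ᵀ * (y * v)) =
      ENNReal.ofReal (Real.pi ^ ((Fintype.card κ : ℝ) / 2)) := by
  obtain ⟨s, hs⟩ := exists_sqrt y
  have hsd : (sᵀ * s).det ≠ 0 := by rwa [hs]
  have hsg : ∀ g : Matrix κ Unit ℝ, (y * g)ᵀ * (y * g) = (s * g)ᵀ * (s * g) := by
    intro g
    rw [Matrix.transpose_mul, Matrix.mul_assoc, ← Matrix.mul_assoc yᵀ, ← hs, Matrix.transpose_mul]
    simp only [Matrix.mul_assoc]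
  simp_rw [hsg]
  rw [← w_congr 1 s y hs]
  have h := lint_mul_left (κ := Unit) s (gram_sq_ne.1 hsd) _
    (ge_measurable.comp (measurable_gram (ι := κ) (κ := Unit)))
  rw [w_nat] at h
  simp only [Fintype.card_unit, Nat.cast_one, Function.comp_apply] at h
  rw [h, gauss_lint]
  simp

lemma scale_lint {t : ℝ} (ht : 0 < t) :
    ∫⁻ v : Matrix κ Unit ℝ, ENNReal.ofReal (Real.exp (-(t * (vᵀ * v).trace))) =
      ENNReal.ofReal (t ^ (-((Fintype.card κ : ℝ) / 2)) * Real.pi ^ ((Fintype.card κ : ℝ) / 2)) := by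
  have hst : 0 < √t := Real.sqrt_pos.2 ht
  have hd : (√t • (1 : Matrix κ κ ℝ)).det = √t ^ (Fintype.card κ) := by
    rw [Matrix.det_smul]; simp
  have h := lint_mul_left (κ := Unit) (√t • (1 : Matrix κ κ ℝ)) (by rw [hd]; positivity) _
    (ge_measurable.comp (measurable_gram (ι := κ) (κ := Unit)))
  simp only [Function.comp_apply, Fintype.card_unit, pow_one, gauss_lint, hd, Matrix.smul_mul,
    Matrix.one_mul, Matrix.transpose_smul, Matrix.mul_smul, smul_smul, Real.mul_self_sqrt ht.le,
    Nat.cast_one, mul_one] at h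
  simp only [ge, Matrix.trace_smul, smul_eq_mul] at h
  rw [abs_of_pos (by positivity)] at h
  have h0 : ENNReal.ofReal (√t ^ Fintype.card κ) ≠ 0 := by
    simp only [ne_eq, ENNReal.ofReal_eq_zero, not_le]; positivity
  rw [← ENNReal.mul_right_inj h0 ENNReal.ofReal_ne_top, h, ← ENNReal.ofReal_mul (by positivity)]
  congr 1
  rw [Real.sqrt_eq_rpow, ← Real.rpow_natCast, ← Real.rpow_mul ht.le, ← mul_assoc,
    ← Real.rpow_add ht]
  ring_nf
  simp

lemma beta_lint {n : ℝ} (hn : (Fintype.card κ : ℝ) < n) :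
    ∫⁻ v : Matrix κ Unit ℝ, ENNReal.ofReal ((1 + (vᵀ * v).trace) ^ (-(n / 2))) =
      ENNReal.ofReal (Real.pi ^ ((Fintype.card κ : ℝ) / 2) *
        Real.Gamma ((n - Fintype.card κ) / 2) / Real.Gamma (n / 2)) := by
  set m := ((Fintype.card κ : ℕ) : ℝ) with hm
  have hm0 : 0 ≤ m := Nat.cast_nonneg _
  have hn0 : 0 < n / 2 := by linarith
  have hG := Real.Gamma_pos_of_pos hn0
  have hG2 : 0 < Real.Gamma ((n - m) / 2) := Real.Gamma_pos_of_pos (by linarith)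
  have htr : ∀ v : Matrix κ Unit ℝ, 0 ≤ (vᵀ * v).trace := by
    intro v
    simp only [Matrix.trace, Matrix.diag_apply, Matrix.mul_apply, Matrix.transpose_apply]
    exact Finset.sum_nonneg fun i _ => Finset.sum_nonneg fun j _ => mul_self_nonneg _
  have hct : Continuous fun v : Matrix κ Unit ℝ => (vᵀ * v).trace := by fun_prop
  have h0 : ENNReal.ofReal (Real.Gamma (n / 2)) ≠ 0 := by
    simp only [ne_eq, ENNReal.ofReal_eq_zero, not_le]; positivity
  rw [← ENNReal.mul_left_inj h0 ENNReal.ofReal_ne_top, ← lintegral_mul_const' _ _ ENNReal.ofReal_ne_top]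
  calc _ = ∫⁻ v : Matrix κ Unit ℝ, ∫⁻ t in Set.Ioi (0 : ℝ),
        ENNReal.ofReal (t ^ (n / 2 - 1) * Real.exp (-((1 + (vᵀ * v).trace) * t))) := by
        apply lintegral_congr
        intro v
        have hp : 0 < 1 + (vᵀ * v).trace := by linarith [htr v]
        rw [gamma_lint hn0 hp, ← ENNReal.ofReal_mul (by positivity), one_div,
          Real.inv_rpow hp.le, Real.rpow_neg hp.le]
    _ = ∫⁻ t in Set.Ioi (0 : ℝ), ∫⁻ v : Matrix κ Unit ℝ,
        ENNReal.ofReal (t ^ (n / 2 - 1) * Real.exp (-((1 + (vᵀ * v).trace) * t))) := by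
        apply lintegral_lintegral_swap
        refine Measurable.aemeasurable (Measurable.ennreal_ofReal (Measurable.mul ?_ ?_))
        · exact measurable_snd.pow_const _
        · refine Real.measurable_exp.comp (Measurable.neg (Measurable.mul ?_ measurable_snd))
          exact (hct.measurable.comp measurable_fst).const_add _
    _ = ∫⁻ t in Set.Ioi (0 : ℝ), ENNReal.ofReal (Real.pi ^ (m / 2)) *
          ENNReal.ofReal (t ^ ((n - m) / 2 - 1) * Real.exp (-(1 * t))) := by
        apply setLIntegral_congr_fun measurableSet_Ioi
        intro t ht
        have ht : 0 < t := ht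
        have e : ∀ v : Matrix κ Unit ℝ,
            ENNReal.ofReal (t ^ (n / 2 - 1) * Real.exp (-((1 + (vᵀ * v).trace) * t))) =
            ENNReal.ofReal (t ^ (n / 2 - 1) * Real.exp (-(1 * t))) *
            ENNReal.ofReal (Real.exp (-(t * (vᵀ * v).trace))) := by
          intro v
          rw [← ENNReal.ofReal_mul (by positivity), mul_assoc, ← Real.exp_add]
          ring_nf
        simp only [e]
        rw [lintegral_const_mul' _ _ ENNReal.ofReal_ne_top, scale_lint ht,
          ← ENNReal.ofReal_mul (by positivity), ← ENNReal.ofReal_mul (by positivity)]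
        congr 1
        have : t ^ ((n - m) / 2 - 1) = t ^ (n / 2 - 1) * t ^ (-(m / 2)) := by
          rw [← Real.rpow_add ht]; ring_nf
        rw [this]
        ring
    _ = _ := by
        rw [lintegral_const_mul' _ _ ENNReal.ofReal_ne_top, gamma_lint (by linarith) one_pos,
          ← ENNReal.ofReal_mul (by positivity), ← ENNReal.ofReal_mul (by positivity)]
        congr 1
        rw [div_one, Real.one_rpow]
        field_simp

lemma claim4 (v : Matrix κ Unit ℝ) :
    ∫⁻ y : Matrix ι κ ℝ, ge (yᵀ * y) * ge ((y * v)ᵀ * (y * v)) =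
      ENNReal.ofReal (Real.pi ^ ((Fintype.card ι * Fintype.card κ : ℝ) / 2)) *
      ENNReal.ofReal ((1 + (vᵀ * v).trace) ^ (-((Fintype.card ι : ℝ) / 2))) := by
  obtain ⟨s, hs⟩ := exists_sqrt (Matrix.fromRows (1 : Matrix κ κ ℝ) vᵀ)
  have hs' : sᵀ * s = 1 + v * vᵀ := by
    rw [hs, Matrix.transpose_fromRows, Matrix.fromCols_mul_fromRows]
    simp
  have htr : 0 ≤ (vᵀ * v).trace := by
    simp only [Matrix.trace, Matrix.diag_apply, Matrix.mul_apply, Matrix.transpose_apply]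
    exact Finset.sum_nonneg fun i _ => Finset.sum_nonneg fun j _ => mul_self_nonneg _
  have hdet : (sᵀ * s).det = 1 + (vᵀ * v).trace := by
    rw [hs', Matrix.det_one_add_mul_comm]
    simp [Matrix.trace]
  have hpos : 0 < 1 + (vᵀ * v).trace := by linarith
  have hsd : (sᵀ * s).det ≠ 0 := by rw [hdet]; positivity
  have hsT : sᵀ.det ≠ 0 := by rw [Matrix.det_transpose]; exact gram_sq_ne.1 hsd
  have h := lint_mul_right (ι := ι) sᵀ hsT _ (ge_measurable.comp (measurable_gram (ι := ι) (κ := κ)))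
  simp only [Function.comp_apply, gauss_lint] at h
  rw [Matrix.det_transpose, w_nat] at h
  have e : ∀ y : Matrix ι κ ℝ, ge (yᵀ * y) * ge ((y * v)ᵀ * (y * v)) =
      ge ((y * sᵀ)ᵀ * (y * sᵀ)) := by
    intro y
    unfold ge
    rw [← ENNReal.ofReal_mul (by positivity), ← Real.exp_add, ← neg_add]
    congr 3
    rw [Matrix.trace_mul_comm (y * sᵀ)ᵀ, Matrix.transpose_mul y sᵀ, Matrix.transpose_transpose,
      Matrix.mul_assoc y, ← Matrix.mul_assoc sᵀ, hs', Matrix.add_mul, Matrix.mul_add,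
      Matrix.one_mul, Matrix.trace_add, Matrix.trace_mul_comm yᵀ, Matrix.trace_mul_comm (y * v)ᵀ,
      Matrix.transpose_mul]
    simp only [Matrix.mul_assoc]
  simp_rw [e]
  rw [← h, mul_right_comm]
  have : w (Fintype.card ι : ℝ) s * ENNReal.ofReal ((1 + (vᵀ * v).trace) ^ (-((Fintype.card ι : ℝ) / 2)))
      = 1 := by
    unfold w
    rw [hdet, ← ENNReal.ofReal_mul (by positivity), Real.sqrt_eq_rpow, ← Real.rpow_mul hpos.le,
      ← Real.rpow_add hpos]
    ring_nf
    simp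
  rw [this, one_mul]

lemma moment_one (P : Matrix ι κ ℝ) (hP : Pᵀ * P = 1) (hlt : Fintype.card κ < Fintype.card ι) :
    ∫⁻ y : Matrix ι κ ℝ, ge (yᵀ * y) * w (-1) y =
      ENNReal.ofReal (Real.pi ^ ((Fintype.card ι * Fintype.card κ : ℝ) / 2) *
        (Real.Gamma (((Fintype.card ι : ℝ) - Fintype.card κ) / 2) /
          Real.Gamma ((Fintype.card ι : ℝ) / 2))) := by
  have hae := ae_gram_ne_zero P hP
  have hlt' : (Fintype.card κ : ℝ) < Fintype.card ι := by exact_mod_cast hlt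
  set m := ((Fintype.card κ : ℕ) : ℝ) with hm
  set n := ((Fintype.card ι : ℕ) : ℝ) with hn
  have hm0 : 0 ≤ m := Nat.cast_nonneg _
  have h0 : ENNReal.ofReal (Real.pi ^ (m / 2)) ≠ 0 := by
    simp only [ne_eq, ENNReal.ofReal_eq_zero, not_le]; positivity
  have hG : 0 < Real.Gamma (n / 2) := Real.Gamma_pos_of_pos (by linarith)
  have hG2 : 0 < Real.Gamma ((n - m) / 2) := Real.Gamma_pos_of_pos (by linarith)
  rw [← ENNReal.mul_left_inj h0 ENNReal.ofReal_ne_top, ← lintegral_mul_const' _ _ ENNReal.ofReal_ne_top]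
  calc _ = ∫⁻ y : Matrix ι κ ℝ, ∫⁻ v : Matrix κ Unit ℝ,
        ge (yᵀ * y) * ge ((y * v)ᵀ * (y * v)) := by
        apply lintegral_congr_ae
        filter_upwards [hae] with y hy
        rw [← claim3 y hy, lintegral_const_mul' (ge (yᵀ * y)) _ ENNReal.ofReal_ne_top, mul_assoc, ← mul_assoc (w (-1) y),
          w_inv_mul _ _ hy, one_mul]
    _ = ∫⁻ v : Matrix κ Unit ℝ, ∫⁻ y : Matrix ι κ ℝ,
        ge (yᵀ * y) * ge ((y * v)ᵀ * (y * v)) := by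
        apply lintegral_lintegral_swap
        refine Measurable.aemeasurable (Measurable.fun_mul ?_ ?_)
        · exact ge_measurable.comp ((measurable_gram (ι := ι) (κ := κ)).comp measurable_fst)
        · exact ge_measurable.comp ((measurable_gram (ι := ι) (κ := Unit)).comp measurable_mul2)
    _ = _ := by
        simp_rw [claim4]
        rw [lintegral_const_mul' _ _ ENNReal.ofReal_ne_top, beta_lint hlt',
          ← ENNReal.ofReal_mul (by positivity), ← ENNReal.ofReal_mul (by positivity)]
        congr 1
        ring

end gauss

section constants
variable {ι ι' κ : Type*} [Fintype ι] [Fintype ι'] [Fintype κ] [DecidableEq ι] [DecidableEq ι']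
  [DecidableEq κ]

lemma Kc_ne_zero (k : ℝ) : Kc κ k ≠ 0 := by
  have hae' : ∀ᵐ g : Matrix κ κ ℝ, (gᵀ * g).det ≠ 0 := ae_gram_ne_zero (1 : Matrix κ κ ℝ) (by simp)
  unfold Kc
  have hM : Measurable fun g : Matrix κ κ ℝ => ge ((g⁻¹)ᵀ * g⁻¹) * w (-k - Fintype.card κ) g := by
    refine Measurable.fun_mul ?_ (w_measurable _)
    exact ge_measurable.comp ((measurable_gram (ι := κ) (κ := κ)).comp measurable_inv_mat)
  intro h
  rw [lintegral_eq_zero_iff hM] at h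
  obtain ⟨g, hg, hg'⟩ := (h.and hae').exists
  have h0 : 0 < √(gᵀ * g).det := Real.sqrt_pos.2 (lt_of_le_of_ne (gram_nonneg g) (Ne.symm hg'))
  simp only [Pi.zero_apply, mul_eq_zero, ge, w, ENNReal.ofReal_eq_zero] at hg
  rcases hg with hg | hg
  · exact absurd hg (not_le.2 (Real.exp_pos _))
  · exact absurd hg (not_le.2 (Real.rpow_pos_of_pos h0 _))

/-- power of determinant weight of a Gram matrix -/
noncomputable def gw (p : ℝ) (r : Matrix κ κ ℝ) : ℝ≥0∞ :=
  ge r * ENNReal.ofReal (√r.det ^ p)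

lemma gw_measurable (p : ℝ) : Measurable (gw p : Matrix κ κ ℝ → ℝ≥0∞) := by
  have hcont : Continuous fun r : Matrix κ κ ℝ => √r.det := by fun_prop
  exact ge_measurable.fun_mul (hcont.measurable.pow_const p).ennreal_ofReal

lemma gw_gram (p : ℝ) (y : Matrix ι κ ℝ) : gw p (yᵀ * y) = ge (yᵀ * y) * w p y := rfl

lemma al_gw (P : Matrix ι κ ℝ) (hP : Pᵀ * P = 1) (k p : ℝ) :
    al ι k (gw (κ := κ) p) = al ι (k + p) (ge (κ := κ)) := by
  unfold al
  apply lintegral_congr_ae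
  filter_upwards [ae_gram_ne_zero P hP] with y hy
  rw [gw_gram, mul_assoc, w_mul _ _ _ hy]
  congr 2
  ring

lemma al_card {k : ℝ} (hk : k = Fintype.card ι) : al ι k (ge (κ := κ)) =
    ENNReal.ofReal (Real.pi ^ ((Fintype.card ι * Fintype.card κ : ℝ) / 2)) := by
  unfold al
  rw [hk]
  simp only [sub_self, w_zero, mul_one]
  exact gauss_lint

lemma al_ge_ne_zero (P : Matrix ι κ ℝ) (hP : Pᵀ * P = 1) (k : ℝ) :
    al ι k (ge (κ := κ)) ≠ 0 := by
  unfold al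
  have hM : Measurable fun y : Matrix ι κ ℝ => ge (yᵀ * y) * w (k - Fintype.card ι) y :=
    (ge_measurable.comp (measurable_gram (ι := ι) (κ := κ))).fun_mul (w_measurable _)
  intro h
  rw [lintegral_eq_zero_iff hM] at h
  obtain ⟨g, hg, hg'⟩ := (h.and (ae_gram_ne_zero P hP)).exists
  have h0 : 0 < √(gᵀ * g).det := Real.sqrt_pos.2 (lt_of_le_of_ne (gram_nonneg g) (Ne.symm hg'))
  simp only [Pi.zero_apply, mul_eq_zero, ge, w, ENNReal.ofReal_eq_zero] at hg
  rcases hg with hg | hg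
  · exact absurd hg (not_le.2 (Real.exp_pos _))
  · exact absurd hg (not_le.2 (Real.rpow_pos_of_pos h0 _))

lemma Kc_ne_top (P : Matrix ι κ ℝ) (hP : Pᵀ * P = 1) {k : ℝ} (hk : k = Fintype.card ι) :
    Kc κ k ≠ ⊤ := by
  intro hK
  have h := key k P hP (gw (Fintype.card κ - k))
    ((gw_measurable _).comp (measurable_gram (ι := κ) (κ := κ)))
    ((gw_measurable _).comp (measurable_gram (ι := ι) (κ := κ)))
  rw [al_gw P hP, al_gw (1 : Matrix κ κ ℝ) (by simp), al_card hk,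
    al_card (ι := κ) (by ring), hK, ENNReal.top_mul (al_ge_ne_zero P hP _)] at h
  exact ENNReal.mul_ne_top ENNReal.ofReal_ne_top ENNReal.ofReal_ne_top h.symm

lemma cross (P : Matrix ι κ ℝ) (hP : Pᵀ * P = 1) (P' : Matrix ι' κ ℝ) (hP' : P'ᵀ * P' = 1)
    {k : ℝ} (hk : k = Fintype.card ι')
    (φ : Matrix κ κ ℝ → ℝ≥0∞) (hφ : Measurable fun g : Matrix κ κ ℝ => φ (gᵀ * g))
    (hφ1 : Measurable fun y : Matrix ι κ ℝ => φ (yᵀ * y))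
    (hφ2 : Measurable fun y : Matrix ι' κ ℝ => φ (yᵀ * y)) :
    al ι k φ * al ι' k (ge (κ := κ)) = al ι' k φ * al ι k (ge (κ := κ)) := by
  have h1 := key k P hP φ hφ hφ1
  have h2 := key k P' hP' φ hφ hφ2
  rw [← ENNReal.mul_right_inj (Kc_ne_zero (κ := κ) k) (Kc_ne_top P' hP' hk), ← mul_assoc, h1,
    ← mul_assoc, h2]
  ring

/-- A frame. -/
def Qm {k m : ℕ} (hkm : m ≤ k) : Matrix (Fin k) (Fin m) ℝ :=
  (1 : Matrix (Fin k) (Fin k) ℝ).submatrix id (Fin.castLE hkm)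

lemma Qm_gram {k m : ℕ} (hkm : m ≤ k) : (Qm hkm)ᵀ * Qm hkm = 1 := by
  ext i j
  simp only [Qm, Matrix.mul_apply, Matrix.one_apply, Matrix.transpose_apply,
    Matrix.submatrix_apply, id, mul_ite, mul_one, mul_zero]
  rw [Finset.sum_ite_eq']
  simp [Fin.ext_iff, eq_comm]

/-- A frame. -/
def Pm {k m : ℕ} (l : ℕ) (hkm : m ≤ k) : Matrix (Fin k ⊕ Fin l) (Fin m) ℝ :=
  Matrix.fromRows (Qm hkm) 0

lemma Pm_gram {k m : ℕ} (l : ℕ) (hkm : m ≤ k) : (Pm l hkm)ᵀ * Pm l hkm = 1 := by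
  rw [Pm, Matrix.transpose_fromRows, Matrix.fromCols_mul_fromRows, Qm_gram]
  simp

lemma siegel_pos {m : ℕ} {a : ℝ} (h : (m : ℝ) / 2 ≤ a) : 0 < SiegelGammaR m a := by
  unfold SiegelGammaR
  refine mul_pos (by positivity) (Finset.prod_pos fun j hj => Real.Gamma_pos_of_pos ?_)
  have : (j : ℝ) < m := by exact_mod_cast Finset.mem_range.1 hj
  linarith

lemma siegel_step {m : ℕ} {a : ℝ} :
    SiegelGammaR m a * Real.Gamma (a + 1 / 2) =
      SiegelGammaR m (a + 1 / 2) * Real.Gamma (a + 1 / 2 - m / 2) := by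
  unfold SiegelGammaR
  have h1 := Finset.prod_range_succ (fun j : ℕ => Real.Gamma (a + 1 / 2 - (j : ℝ) / 2)) m
  rw [Finset.prod_range_succ'] at h1
  have h2 : ∀ j : ℕ, a + 1 / 2 - ((j + 1 : ℕ) : ℝ) / 2 = a - (j : ℝ) / 2 := by
    intro j; push_cast; ring
  simp only [h2] at h1
  simp only [Nat.cast_zero, zero_div, sub_zero] at h1
  rw [mul_assoc, mul_assoc, h1]

lemma moment (k m : ℕ) (hkm : m ≤ k) (l : ℕ) :
    al (Fin k ⊕ Fin l) (k : ℝ) (ge (κ := Fin m)) =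
      ENNReal.ofReal (Real.pi ^ ((((k : ℝ) + l) * m) / 2) *
        (SiegelGammaR m ((k : ℝ) / 2) / SiegelGammaR m (((k : ℝ) + l) / 2))) := by
  have hkm' : (m : ℝ) ≤ k := by exact_mod_cast hkm
  have hk0 : 0 < SiegelGammaR m ((k : ℝ) / 2) := siegel_pos (by linarith)
  induction l with
  | zero =>
    rw [al_card (by simp)]
    simp only [Fintype.card_sum, Fintype.card_fin, Nat.cast_zero, add_zero]
    rw [div_self hk0.ne', mul_one]
  | succ l ih =>
    have hl0 : (0 : ℝ) ≤ l := Nat.cast_nonneg _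
    have h := cross (Pm (l + 1) hkm) (Pm_gram _ _) (Pm l hkm) (Pm_gram _ _)
      (k := (k : ℝ) + l) (by simp) (gw (-(l : ℝ)))
      ((gw_measurable _).comp (measurable_gram (ι := Fin m) (κ := Fin m)))
      ((gw_measurable _).comp (measurable_gram (κ := Fin m)))
      ((gw_measurable _).comp (measurable_gram (κ := Fin m)))
    rw [al_gw (Pm (l + 1) hkm) (Pm_gram _ _), al_gw (Pm l hkm) (Pm_gram _ _),
      al_card (ι := Fin k ⊕ Fin l) (κ := Fin m) (k := (k : ℝ) + l) (by simp), add_neg_cancel_right, ih] at h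
    have hm1 := moment_one (Pm (l + 1) hkm) (Pm_gram _ _) (by simp; omega)
    have hm2 : al (Fin k ⊕ Fin (l + 1)) ((k : ℝ) + l) (ge (κ := Fin m)) =
        ∫⁻ y : Matrix (Fin k ⊕ Fin (l + 1)) (Fin m) ℝ, ge (yᵀ * y) * w (-1) y := by
      unfold al
      congr 1
      funext y
      congr 2
      simp
    rw [hm2, hm1] at h
    simp only [Fintype.card_sum, Fintype.card_fin] at h
    push_cast at h ⊢
    set a : ℝ := ((k : ℝ) + l) / 2 with ha
    have hS := siegel_step (m := m) (a := a)
    have e1 : ((k : ℝ) + (l + 1)) / 2 = a + 1 / 2 := by rw [ha]; ring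
    have e2 : ((k : ℝ) + (l + 1) - m) / 2 = a + 1 / 2 - m / 2 := by rw [ha]; ring
    have e3 : ((k : ℝ) + (l + 1)) * m / 2 = (a + 1 / 2) * m := by rw [ha]; ring
    have e4 : ((k : ℝ) + l) * m / 2 = a * m := by rw [ha]; ring
    have p1 : 0 < SiegelGammaR m a := siegel_pos (by rw [ha]; linarith)
    have p2 : 0 < SiegelGammaR m (a + 1 / 2) := siegel_pos (by rw [ha]; linarith)
    have p3 : 0 < Real.Gamma (a + 1 / 2) := Real.Gamma_pos_of_pos (by rw [ha]; positivity)
    have p4 : 0 < Real.Gamma (a + 1 / 2 - m / 2) := Real.Gamma_pos_of_pos (by rw [ha]; linarith)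
    rw [e1, e2, e3, e4] at h
    rw [e1, e3]
    have h0 : ENNReal.ofReal (Real.pi ^ (a * m)) ≠ 0 := by
      simp only [ne_eq, ENNReal.ofReal_eq_zero, not_le]; positivity
    rw [← ENNReal.mul_left_inj h0 ENNReal.ofReal_ne_top, h, ← ENNReal.ofReal_mul (by positivity),
      ← ENNReal.ofReal_mul (by positivity)]
    congr 1
    generalize Real.Gamma (a + 1 / 2) = G1 at *
    generalize Real.Gamma (a + 1 / 2 - m / 2) = G2 at *
    generalize SiegelGammaR m (a + 1 / 2) = S2 at *
    generalize SiegelGammaR m a = S1 at *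
    field_simp
    linear_combination (-1 : ℝ) * hS

end constants

section ortho
variable {ι κ : Type*} [Fintype ι] [Fintype κ] [DecidableEq ι] [DecidableEq κ]

lemma norm_toEuclideanLin (y : Matrix ι κ ℝ) (v : EuclideanSpace ℝ κ) :
    ‖Matrix.toEuclideanLin y v‖ ^ 2 = v.ofLp ⬝ᵥ ((yᵀ * y) *ᵥ v.ofLp) := by
  rw [EuclideanSpace.real_norm_sq_eq]
  rw [← Matrix.mulVec_mulVec, Matrix.dotProduct_mulVec, Matrix.vecMul_transpose]
  simp [dotProduct, Matrix.toLpLin_apply, pow_two]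

lemma exists_ortho (y z : Matrix ι κ ℝ) (h : yᵀ * y = zᵀ * z) :
    ∃ ρ : Matrix ι ι ℝ, ρᵀ * ρ = 1 ∧ ρ * y = z := by
  set A := Matrix.toEuclideanLin y with hA
  set B := Matrix.toEuclideanLin z with hB
  have hn : ∀ v, ‖A v‖ = ‖B v‖ := by
    intro v
    have h1 := norm_toEuclideanLin y v
    have h2 := norm_toEuclideanLin z v
    rw [h, ← h2] at h1
    exact (sq_eq_sq₀ (norm_nonneg _) (norm_nonneg _)).1 h1
  have hker : LinearMap.ker A ≤ LinearMap.ker B := by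
    intro v hv
    rw [LinearMap.mem_ker] at hv ⊢
    rw [← norm_eq_zero, ← hn, hv, norm_zero]
  let L0 : LinearMap.range A →ₗ[ℝ] EuclideanSpace ℝ ι :=
    ((LinearMap.ker A).liftQ B hker).comp A.quotKerEquivRange.symm.toLinearMap
  have hL0 : ∀ v, L0 ⟨A v, LinearMap.mem_range_self A v⟩ = B v := by
    intro v
    have : A.quotKerEquivRange.symm ⟨A v, LinearMap.mem_range_self A v⟩ =
        (LinearMap.ker A).mkQ v := LinearMap.quotKerEquivRange_symm_apply_image A v _
    simp only [L0, LinearMap.comp_apply, LinearEquiv.coe_coe, this]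
    rfl
  let L1 : LinearMap.range A →ₗᵢ[ℝ] EuclideanSpace ℝ ι :=
    { toLinearMap := L0
      norm_map' := by
        rintro ⟨_, v, rfl⟩
        rw [hL0]
        exact (hn v).symm }
  set L := L1.extend with hL
  have hLA : ∀ v, L (A v) = B v := by
    intro v
    rw [hL]
    rw [L1.extend_apply ⟨A v, LinearMap.mem_range_self A v⟩]
    exact hL0 v
  set ρ : Matrix ι ι ℝ := Matrix.toEuclideanLin.symm L.toLinearMap with hρ
  have hρL : ∀ x, WithLp.toLp 2 (ρ *ᵥ x) = L (WithLp.toLp 2 x) := by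
    intro x
    have : Matrix.toEuclideanLin ρ = L.toLinearMap := by rw [hρ]; simp
    calc _ = Matrix.toEuclideanLin ρ (WithLp.toLp 2 x) := by simp [Matrix.toLpLin_apply]
      _ = _ := by rw [this]; rfl
  refine ⟨ρ, ?_, ?_⟩
  · ext i j
    have h1 := L.inner_map_map (WithLp.toLp 2 (Pi.single j 1)) (WithLp.toLp 2 (Pi.single i 1))
    rw [← hρL, ← hρL] at h1
    simp only [EuclideanSpace.inner_toLp_toLp, Matrix.mulVec_single_one] at h1
    simpa [dotProduct, Matrix.mul_apply, Matrix.one_apply, Pi.single_apply, eq_comm (a := j)] using h1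
  · ext i j
    have h1 := hLA (WithLp.toLp 2 (Pi.single j 1))
    simp only [hA, hB, Matrix.toLpLin_apply] at h1
    rw [← hρL] at h1
    have h2 := congrFun (congrArg WithLp.ofLp h1) i
    have h3 : (ρ *ᵥ y.col j) i = z i j := by simpa using h2
    rw [Matrix.mul_apply, ← h3]
    rfl

lemma exists_so {k l m : ℕ} (hl : 0 < l) (u : Matrix (Fin k) (Fin m) ℝ)
    (y : Matrix (Fin k ⊕ Fin l) (Fin m) ℝ)
    (h : (Matrix.fromRows u (0 : Matrix (Fin l) (Fin m) ℝ))ᵀ *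
      Matrix.fromRows u (0 : Matrix (Fin l) (Fin m) ℝ) = yᵀ * y) :
    ∃ ρ : Matrix (Fin k ⊕ Fin l) (Fin k ⊕ Fin l) ℝ, ρᵀ * ρ = 1 ∧ ρ.det = 1 ∧
      ρ * Matrix.fromRows u (0 : Matrix (Fin l) (Fin m) ℝ) = y := by
  obtain ⟨ρ, h1, h2⟩ := exists_ortho _ _ h
  have hd : ρ.det * ρ.det = 1 := by
    have := congrArg Matrix.det h1
    simpa using this
  rcases mul_self_eq_one_iff.1 hd with hd | hd
  · exact ⟨ρ, h1, hd, h2⟩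
  · let d : Fin k ⊕ Fin l → ℝ := fun i => if i = Sum.inr ⟨0, hl⟩ then -1 else 1
    let R : Matrix (Fin k ⊕ Fin l) (Fin k ⊕ Fin l) ℝ := Matrix.diagonal d
    refine ⟨ρ * R, ?_, ?_, ?_⟩
    · rw [Matrix.transpose_mul, Matrix.mul_assoc, ← Matrix.mul_assoc ρᵀ, h1, Matrix.one_mul]
      simp only [R, Matrix.diagonal_transpose, Matrix.diagonal_mul_diagonal]
      rw [← Matrix.diagonal_one]
      congr 1
      funext i
      simp only [d]
      split_ifs <;> norm_num
    · rw [Matrix.det_mul, hd]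
      simp only [R, Matrix.det_diagonal, d]
      rw [Finset.prod_ite_eq' Finset.univ (Sum.inr (⟨0, hl⟩ : Fin l) : Fin k ⊕ Fin l) (fun _ => (-1 : ℝ))]
      simp
    · rw [Matrix.mul_assoc]
      have : R * Matrix.fromRows u (0 : Matrix (Fin l) (Fin m) ℝ) = Matrix.fromRows u 0 := by
        ext i j
        rw [Matrix.diagonal_mul]
        rcases i with i | i <;> simp [d]
      rw [this, h2]

end ortho

section haar
variable {ι κ : Type*} [Fintype ι] [Fintype κ] [DecidableEq ι] [DecidableEq κ]
  {μ : Measure (Matrix ι ι ℝ)} [IsProbabilityMeasure μ]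

lemma mt : Measurable fun g : Matrix ι κ ℝ => gᵀ :=
  (by fun_prop : Continuous fun g : Matrix ι κ ℝ => gᵀ).measurable

lemma lint_transpose (hμso : ∀ᵐ γ ∂μ, γᵀ * γ = 1 ∧ γ.det = 1)
    (hμinv : ∀ ρ : Matrix ι ι ℝ, ρᵀ * ρ = 1 → ρ.det = 1 → MeasurePreserving (fun γ => ρ * γ) μ μ)
    (F : Matrix ι ι ℝ → ℝ≥0∞) (hF : Measurable F) : ∫⁻ γ, F γᵀ ∂μ = ∫⁻ γ, F γ ∂μ := by
  have h1 : ∫⁻ δ, ∫⁻ γ, F (δᵀ * γ) ∂μ ∂μ = ∫⁻ γ, F γ ∂μ := by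
    have : ∀ᵐ δ ∂μ, ∫⁻ γ, F (δᵀ * γ) ∂μ = ∫⁻ γ, F γ ∂μ := by
      filter_upwards [hμso] with δ hδ
      refine (hμinv δᵀ ?_ ?_).lintegral_comp hF
      · rw [Matrix.transpose_transpose]; exact mul_eq_one_comm.1 hδ.1
      · rw [Matrix.det_transpose]; exact hδ.2
    rw [lintegral_congr_ae this]
    simp
  have hM : Measurable fun p : Matrix ι ι ℝ × Matrix ι ι ℝ => F (p.1ᵀ * p.2) :=
    hF.comp ((by fun_prop : Continuous fun p : Matrix ι ι ℝ × Matrix ι ι ℝ => p.1ᵀ * p.2).measurable)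
  rw [← h1, lintegral_lintegral_swap hM.aemeasurable]
  have : ∀ᵐ γ ∂μ, ∫⁻ δ, F (δᵀ * γ) ∂μ = ∫⁻ δ, F δᵀ ∂μ := by
    filter_upwards [hμso] with γ hγ
    have := (hμinv γᵀ (by rw [Matrix.transpose_transpose]; exact mul_eq_one_comm.1 hγ.1)
      (by rw [Matrix.det_transpose]; exact hγ.2)).lintegral_comp (hF.comp mt)
    rw [← show ∫⁻ δ, (F ∘ fun g => gᵀ) δ ∂μ = ∫⁻ δ, F δᵀ ∂μ from rfl, ← this]
    simp [Matrix.transpose_mul]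
  rw [lintegral_congr_ae this]
  simp

lemma lint_right (hμso : ∀ᵐ γ ∂μ, γᵀ * γ = 1 ∧ γ.det = 1)
    (hμinv : ∀ ρ : Matrix ι ι ℝ, ρᵀ * ρ = 1 → ρ.det = 1 → MeasurePreserving (fun γ => ρ * γ) μ μ)
    (F : Matrix ι ι ℝ → ℝ≥0∞) (hF : Measurable F) (ρ : Matrix ι ι ℝ) (h1 : ρᵀ * ρ = 1)
    (h2 : ρ.det = 1) : ∫⁻ γ, F (γ * ρ) ∂μ = ∫⁻ γ, F γ ∂μ := by
  have hM : Measurable fun γ : Matrix ι ι ℝ => F (γ * ρ) :=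
    hF.comp ((by fun_prop : Continuous fun γ : Matrix ι ι ℝ => γ * ρ).measurable)
  rw [← lint_transpose hμso hμinv _ hM, ← lint_transpose hμso hμinv F hF]
  have := (hμinv ρᵀ (by rw [Matrix.transpose_transpose]; exact mul_eq_one_comm.1 h1)
      (by rw [Matrix.det_transpose]; exact h2)).lintegral_comp (hF.comp mt)
  rw [← show ∫⁻ δ, (F ∘ fun g => gᵀ) δ ∂μ = ∫⁻ δ, F δᵀ ∂μ from rfl, ← this]
  simp [Matrix.transpose_mul]

end haar

section main
variable {k l m : ℕ} {μ : Measure (Matrix (Fin k ⊕ Fin l) (Fin k ⊕ Fin l) ℝ)}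
  [IsProbabilityMeasure μ]

/-- embedding `u ↦ [u; 0]` -/
def emb (l : ℕ) {k m : ℕ} (u : Matrix (Fin k) (Fin m) ℝ) : Matrix (Fin k ⊕ Fin l) (Fin m) ℝ :=
  Matrix.fromRows u (0 : Matrix (Fin l) (Fin m) ℝ)

lemma emb_continuous : Continuous (emb l : Matrix (Fin k) (Fin m) ℝ → _) := by
  refine continuous_matrix fun i j => ?_
  rcases i with i | i
  · simp only [emb, Matrix.fromRows_apply_inl]; fun_prop
  · simp only [emb, Matrix.fromRows_apply_inr]; fun_prop

lemma emb_gram (u : Matrix (Fin k) (Fin m) ℝ) : (emb l u)ᵀ * emb l u = uᵀ * u := by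
  rw [emb, Matrix.transpose_fromRows, Matrix.fromCols_mul_fromRows]
  simp

lemma Pm_mul (hkm : m ≤ k) (s : Matrix (Fin m) (Fin m) ℝ) :
    Pm l hkm * s = emb l (Qm hkm * s) := by
  rw [Pm, emb, Matrix.fromRows_mul, Matrix.zero_mul]

lemma Qm_mul_gram (hkm : m ≤ k) (s : Matrix (Fin m) (Fin m) ℝ) :
    (Qm hkm * s)ᵀ * (Qm hkm * s) = sᵀ * s := by
  rw [Matrix.transpose_mul, Matrix.mul_assoc, ← Matrix.mul_assoc (Qm hkm)ᵀ, Qm_gram,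
    Matrix.one_mul]

/-- averaging over the group -/
noncomputable def Ph (μ : Measure (Matrix (Fin k ⊕ Fin l) (Fin k ⊕ Fin l) ℝ))
    (F : Matrix (Fin k ⊕ Fin l) (Fin m) ℝ → ℝ≥0∞) (y : Matrix (Fin k ⊕ Fin l) (Fin m) ℝ) : ℝ≥0∞ :=
  ∫⁻ γ, F (γ * y) ∂μ

lemma Ph_measurable {F : Matrix (Fin k ⊕ Fin l) (Fin m) ℝ → ℝ≥0∞} (hF : Measurable F) :
    Measurable (Ph μ F) := by
  unfold Ph
  have : Measurable fun p : Matrix (Fin k ⊕ Fin l) (Fin m) ℝ ×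
      Matrix (Fin k ⊕ Fin l) (Fin k ⊕ Fin l) ℝ => F (p.2 * p.1) :=
    hF.comp ((by fun_prop : Continuous fun p : Matrix (Fin k ⊕ Fin l) (Fin m) ℝ ×
      Matrix (Fin k ⊕ Fin l) (Fin k ⊕ Fin l) ℝ => p.2 * p.1).measurable)
  exact this.lintegral_prod_right'

open Classical in
/-- the profile of an invariant function -/
noncomputable def prof (hkm : m ≤ k) (G : Matrix (Fin k ⊕ Fin l) (Fin m) ℝ → ℝ≥0∞)
    (r : Matrix (Fin m) (Fin m) ℝ) : ℝ≥0∞ :=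
  if h : ∃ s : Matrix (Fin m) (Fin m) ℝ, sᵀ * s = r then G (Pm l hkm * h.choose) else 0

lemma Ph_inv (hμso : ∀ᵐ γ ∂μ, γᵀ * γ = 1 ∧ γ.det = 1)
    (hμinv : ∀ ρ : Matrix (Fin k ⊕ Fin l) (Fin k ⊕ Fin l) ℝ, ρᵀ * ρ = 1 → ρ.det = 1 →
      MeasurePreserving (fun γ => ρ * γ) μ μ)
    {F : Matrix (Fin k ⊕ Fin l) (Fin m) ℝ → ℝ≥0∞} (hF : Measurable F)
    (ρ : Matrix (Fin k ⊕ Fin l) (Fin k ⊕ Fin l) ℝ) (h1 : ρᵀ * ρ = 1) (h2 : ρ.det = 1)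
    (y : Matrix (Fin k ⊕ Fin l) (Fin m) ℝ) : Ph μ F (ρ * y) = Ph μ F y := by
  unfold Ph
  have hM : Measurable fun γ : Matrix (Fin k ⊕ Fin l) (Fin k ⊕ Fin l) ℝ => F (γ * y) :=
    hF.comp ((by fun_prop : Continuous
      fun γ : Matrix (Fin k ⊕ Fin l) (Fin k ⊕ Fin l) ℝ => γ * y).measurable)
  rw [← lint_right hμso hμinv _ hM ρ h1 h2]
  simp only [Matrix.mul_assoc]

lemma prof_gram (hl : 0 < l) (hkm : m ≤ k) (hμso : ∀ᵐ γ ∂μ, γᵀ * γ = 1 ∧ γ.det = 1)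
    (hμinv : ∀ ρ : Matrix (Fin k ⊕ Fin l) (Fin k ⊕ Fin l) ℝ, ρᵀ * ρ = 1 → ρ.det = 1 →
      MeasurePreserving (fun γ => ρ * γ) μ μ)
    {F : Matrix (Fin k ⊕ Fin l) (Fin m) ℝ → ℝ≥0∞} (hF : Measurable F)
    (y : Matrix (Fin k ⊕ Fin l) (Fin m) ℝ) : prof hkm (Ph μ F) (yᵀ * y) = Ph μ F y := by
  have hex := exists_sqrt y
  rw [prof, dif_pos hex]
  have hs := hex.choose_spec
  set s := hex.choose
  obtain ⟨ρ, h1, h2, h3⟩ := exists_so hl (Qm hkm * s) y (by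
    have := emb_gram (l := l) (Qm hkm * s)
    rw [Qm_mul_gram, hs] at this
    exact this)
  have h3' : ρ * emb l (Qm hkm * s) = y := h3
  rw [← h3', Ph_inv hμso hμinv hF ρ h1 h2, Pm_mul]

lemma main_lint (hl : 0 < l) (hkm : m ≤ k) (hμso : ∀ᵐ γ ∂μ, γᵀ * γ = 1 ∧ γ.det = 1)
    (hμinv : ∀ ρ : Matrix (Fin k ⊕ Fin l) (Fin k ⊕ Fin l) ℝ, ρᵀ * ρ = 1 → ρ.det = 1 →
      MeasurePreserving (fun γ => ρ * γ) μ μ)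
    {F : Matrix (Fin k ⊕ Fin l) (Fin m) ℝ → ℝ≥0∞} (hF : Measurable F) :
    (∫⁻ γ, (∫⁻ u : Matrix (Fin k) (Fin m) ℝ, F (γ * emb l u)) ∂μ) *
      al (Fin k ⊕ Fin l) (k : ℝ) (ge (κ := Fin m)) =
    (∫⁻ y : Matrix (Fin k ⊕ Fin l) (Fin m) ℝ, F y * w ((k : ℝ) - (k + l)) y) *
      ENNReal.ofReal (Real.pi ^ (((k : ℝ) * m) / 2)) := by
  have hP := fun y => prof_gram hl hkm hμso hμinv hF y
  have hPm := Ph_measurable (μ := μ) hF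
  have hP1 : ∀ u : Matrix (Fin k) (Fin m) ℝ, prof hkm (Ph μ F) (uᵀ * u) = Ph μ F (emb l u) := by
    intro u; rw [← emb_gram (l := l), hP]
  have hP2 : ∀ s : Matrix (Fin m) (Fin m) ℝ, prof hkm (Ph μ F) (sᵀ * s) =
      Ph μ F (emb l (Qm hkm * s)) := by
    intro u; rw [← Qm_mul_gram hkm, hP1]
  have h := cross (Pm l hkm) (Pm_gram _ _) (Qm hkm) (Qm_gram _) (k := (k : ℝ)) (by simp)
    (prof hkm (Ph μ F))
    (by
      simp only [hP2]
      exact hPm.comp (emb_continuous.comp (by fun_prop)).measurable)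
    (by simp only [hP]; exact hPm)
    (by simp only [hP1]; exact hPm.comp emb_continuous.measurable)
  rw [al_card (ι := Fin k) (κ := Fin m) (k := (k : ℝ)) (by simp)] at h
  have e1 : al (Fin k) (k : ℝ) (prof hkm (Ph μ F)) =
      ∫⁻ γ, (∫⁻ u : Matrix (Fin k) (Fin m) ℝ, F (γ * emb l u)) ∂μ := by
    unfold al
    simp only [Fintype.card_fin, sub_self, w_zero, mul_one, hP1]
    unfold Ph
    rw [lintegral_lintegral_swap]
    have hc : Continuous fun p : Matrix (Fin k) (Fin m) ℝ ×
      Matrix (Fin k ⊕ Fin l) (Fin k ⊕ Fin l) ℝ => p.2 * emb l p.1 :=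
      continuous_snd.matrix_mul (emb_continuous.comp continuous_fst)
    exact (hF.comp hc.measurable).aemeasurable
  have e2 : al (Fin k ⊕ Fin l) (k : ℝ) (prof hkm (Ph μ F)) =
      ∫⁻ y : Matrix (Fin k ⊕ Fin l) (Fin m) ℝ, F y * w ((k : ℝ) - (k + l)) y := by
    unfold al
    simp only [Fintype.card_sum, Fintype.card_fin, Nat.cast_add, hP]
    unfold Ph
    have hc : Continuous fun p : Matrix (Fin k ⊕ Fin l) (Fin m) ℝ ×
      Matrix (Fin k ⊕ Fin l) (Fin k ⊕ Fin l) ℝ => p.2 * p.1 := by fun_prop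
    have : ∀ y : Matrix (Fin k ⊕ Fin l) (Fin m) ℝ,
        (∫⁻ γ, F (γ * y) ∂μ) * w ((k : ℝ) - (k + l)) y =
        ∫⁻ γ, F (γ * y) * w ((k : ℝ) - (k + l)) y ∂μ := by
      intro y
      rw [lintegral_mul_const' _ _ (w_ne_top _ _)]
    simp only [this]
    rw [lintegral_lintegral_swap
      ((hF.comp hc.measurable).mul ((w_measurable _).comp measurable_fst)).aemeasurable]
    have h2 : ∀ᵐ γ ∂μ, ∫⁻ y : Matrix (Fin k ⊕ Fin l) (Fin m) ℝ,
        F (γ * y) * w ((k : ℝ) - (k + l)) y =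
        ∫⁻ y : Matrix (Fin k ⊕ Fin l) (Fin m) ℝ, F y * w ((k : ℝ) - (k + l)) y := by
      filter_upwards [hμso] with γ hγ
      have hw : ∀ y : Matrix (Fin k ⊕ Fin l) (Fin m) ℝ,
          w ((k : ℝ) - (k + l)) y = w ((k : ℝ) - (k + l)) (γ * y) := by
        intro y
        apply w_congr
        rw [Matrix.transpose_mul, Matrix.mul_assoc, ← Matrix.mul_assoc γᵀ, hγ.1, Matrix.one_mul]
      have h3 := lint_mul_left γ (by rw [hγ.2]; norm_num)
        (fun y : Matrix (Fin k ⊕ Fin l) (Fin m) ℝ => F y * w ((k : ℝ) - (k + l)) y)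
        (hF.fun_mul (w_measurable _))
      rw [hγ.2] at h3
      simp only [abs_one, one_pow, ENNReal.ofReal_one, one_mul] at h3
      rw [← h3]
      apply lintegral_congr
      intro y
      rw [← hw]
    rw [lintegral_congr_ae h2]
    simp
  rw [e1, e2] at h
  simp only [Fintype.card_fin] at h
  exact h.symm

/-- the density constant -/
noncomputable def cst (k l m : ℕ) : ℝ :=
  Real.pi ^ (-((l : ℝ) * m) / 2) *
    (SiegelGammaR m (((k : ℝ) + l) / 2) / SiegelGammaR m ((k : ℝ) / 2))

lemma cst_pos (hkm : m ≤ k) : 0 < cst k l m := by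
  have hkm' : (m : ℝ) ≤ k := by exact_mod_cast hkm
  have hl0 : (0 : ℝ) ≤ l := Nat.cast_nonneg _
  have h1 : 0 < SiegelGammaR m ((k : ℝ) / 2) := siegel_pos (by linarith)
  have h2 : 0 < SiegelGammaR m (((k : ℝ) + l) / 2) := siegel_pos (by linarith)
  unfold cst
  positivity

lemma main_lint' (hl : 0 < l) (hkm : m ≤ k) (hμso : ∀ᵐ γ ∂μ, γᵀ * γ = 1 ∧ γ.det = 1)
    (hμinv : ∀ ρ : Matrix (Fin k ⊕ Fin l) (Fin k ⊕ Fin l) ℝ, ρᵀ * ρ = 1 → ρ.det = 1 →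
      MeasurePreserving (fun γ => ρ * γ) μ μ)
    {F : Matrix (Fin k ⊕ Fin l) (Fin m) ℝ → ℝ≥0∞} (hF : Measurable F) :
    (∫⁻ γ, (∫⁻ u : Matrix (Fin k) (Fin m) ℝ, F (γ * emb l u)) ∂μ) =
    ENNReal.ofReal (cst k l m) *
      ∫⁻ y : Matrix (Fin k ⊕ Fin l) (Fin m) ℝ, w ((k : ℝ) - (k + l)) y * F y := by
  have h := main_lint hl hkm hμso hμinv hF
  have hkm' : (m : ℝ) ≤ k := by exact_mod_cast hkm
  have hl0 : (0 : ℝ) ≤ l := Nat.cast_nonneg _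
  have h1 : 0 < SiegelGammaR m ((k : ℝ) / 2) := siegel_pos (by linarith)
  have h2 : 0 < SiegelGammaR m (((k : ℝ) + l) / 2) := siegel_pos (by linarith)
  rw [moment k m hkm l] at h
  set Z := Real.pi ^ ((((k : ℝ) + l) * m) / 2) *
        (SiegelGammaR m ((k : ℝ) / 2) / SiegelGammaR m (((k : ℝ) + l) / 2)) with hZ
  have hZ0 : 0 < Z := by positivity
  have hc : Real.pi ^ (((k : ℝ) * m) / 2) = cst k l m * Z := by
    have : Real.pi ^ (((k : ℝ) * m) / 2) = Real.pi ^ (-((l : ℝ) * m) / 2) *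
      Real.pi ^ ((((k : ℝ) + l) * m) / 2) := by
      rw [← Real.rpow_add Real.pi_pos]; congr 1; ring
    rw [this, hZ, cst]
    generalize SiegelGammaR m (((k : ℝ) + l) / 2) = S2 at *
    generalize SiegelGammaR m ((k : ℝ) / 2) = S1 at *
    field_simp
  rw [hc, ENNReal.ofReal_mul (cst_pos hkm).le, ← mul_assoc,
    ENNReal.mul_left_inj (by simpa using hZ0) ENNReal.ofReal_ne_top] at h
  rw [h, mul_comm]
  simp only [mul_comm]

lemma main_map (hl : 0 < l) (hkm : m ≤ k) (hμso : ∀ᵐ γ ∂μ, γᵀ * γ = 1 ∧ γ.det = 1)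
    (hμinv : ∀ ρ : Matrix (Fin k ⊕ Fin l) (Fin k ⊕ Fin l) ℝ, ρᵀ * ρ = 1 → ρ.det = 1 →
      MeasurePreserving (fun γ => ρ * γ) μ μ) :
    Measure.map (fun p : Matrix (Fin k ⊕ Fin l) (Fin k ⊕ Fin l) ℝ × Matrix (Fin k) (Fin m) ℝ =>
        p.1 * emb l p.2) (μ.prod volume) =
      ENNReal.ofReal (cst k l m) •
        (volume : Measure (Matrix (Fin k ⊕ Fin l) (Fin m) ℝ)).withDensity
          (w ((k : ℝ) - (k + l))) := by
  have hc : Continuous fun p : Matrix (Fin k ⊕ Fin l) (Fin k ⊕ Fin l) ℝ ×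
      Matrix (Fin k) (Fin m) ℝ => p.1 * emb l p.2 :=
    continuous_fst.matrix_mul (emb_continuous.comp continuous_snd)
  refine Measure.ext_of_lintegral _ fun F hF => ?_
  rw [lintegral_map hF hc.measurable, lintegral_prod (fun p : Matrix (Fin k ⊕ Fin l) (Fin k ⊕ Fin l) ℝ ×
      Matrix (Fin k) (Fin m) ℝ => F (p.1 * emb l p.2)) (hF.comp hc.measurable).aemeasurable,
    lintegral_smul_measure, lintegral_withDensity_eq_lintegral_mul _ (w_measurable _) hF,
    main_lint' hl hkm hμso hμinv hF]
  rfl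

end main

section final
variable {k l m : ℕ} {μ : Measure (Matrix (Fin k ⊕ Fin l) (Fin k ⊕ Fin l) ℝ)}
  [IsProbabilityMeasure μ]

lemma final_right (f : Matrix (Fin k ⊕ Fin l) (Fin m) ℝ → ℝ)
    (x : Matrix (Fin k ⊕ Fin l) (Fin m) ℝ) :
    ∫ y : Matrix (Fin k ⊕ Fin l) (Fin m) ℝ,
          f (x - y) * ((yᵀ * y).det) ^ (((k : ℝ) - (k + l)) / 2) =
    ∫ y : Matrix (Fin k ⊕ Fin l) (Fin m) ℝ,
          f (x + y) * √((yᵀ * y).det) ^ ((k : ℝ) - (k + l)) := by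
  rw [← integral_neg_eq_self]
  congr 1
  funext y
  rw [sub_neg_eq_add, Real.sqrt_eq_rpow, ← Real.rpow_mul (gram_nonneg y), Matrix.transpose_neg,
    Matrix.neg_mul, Matrix.mul_neg, neg_neg]
  congr 2
  ring

lemma decomp (γ : Matrix (Fin k ⊕ Fin l) (Fin k ⊕ Fin l) ℝ) (hγ : γᵀ * γ = 1)
    (x : Matrix (Fin k ⊕ Fin l) (Fin m) ℝ) (u : Matrix (Fin k) (Fin m) ℝ) :
    γ * Matrix.fromRows (u + (γᵀ * x).toRows₁) ((xi0 k l)ᵀ * γᵀ * x) = x + γ * emb l u := by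
  have h1 : Matrix.fromRows (u + (γᵀ * x).toRows₁) ((xi0 k l)ᵀ * γᵀ * x) =
      γᵀ * x + emb l u := by
    rw [Matrix.mul_assoc]
    generalize γᵀ * x = z
    ext i j
    rcases i with i | i
    · simp [emb, add_comm]
    · have : (xi0 k l)ᵀ * z = z.toRows₂ := by
        conv_lhs => rw [← Matrix.fromRows_toRows z]
        rw [xi0, Matrix.transpose_fromRows, Matrix.fromCols_mul_fromRows]
        simp
      simp [emb, this]
  rw [h1, Matrix.mul_add, ← Matrix.mul_assoc, mul_eq_one_comm.1 hγ, Matrix.one_mul]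

lemma final_left (hl : 0 < l) (hkm : m ≤ k) (hμso : ∀ᵐ γ ∂μ, γᵀ * γ = 1 ∧ γ.det = 1)
    (hμinv : ∀ ρ : Matrix (Fin k ⊕ Fin l) (Fin k ⊕ Fin l) ℝ, ρᵀ * ρ = 1 → ρ.det = 1 →
      MeasurePreserving (fun γ => ρ * γ) μ μ)
    (f : Matrix (Fin k ⊕ Fin l) (Fin m) ℝ → ℝ) (hfloc : LocallyIntegrable f)
    (x : Matrix (Fin k ⊕ Fin l) (Fin m) ℝ)
    (habs : Integrable
      (fun p : Matrix (Fin k ⊕ Fin l) (Fin k ⊕ Fin l) ℝ × Matrix (Fin k) (Fin m) ℝ =>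
        |f (x + p.1 * Matrix.fromRows p.2 (0 : Matrix (Fin l) (Fin m) ℝ))|)
      (μ.prod volume)) :
    (∫ γ, (∫ u : Matrix (Fin k) (Fin m) ℝ,
            f (γ * Matrix.fromRows u ((xi0 k l)ᵀ * γᵀ * x))) ∂μ) =
      cst k l m * ∫ y : Matrix (Fin k ⊕ Fin l) (Fin m) ℝ,
          f (x + y) * √((yᵀ * y).det) ^ ((k : ℝ) - (k + l)) := by
  have hmap := main_map (μ := μ) hl hkm hμso hμinv
  have hc : Continuous fun p : Matrix (Fin k ⊕ Fin l) (Fin k ⊕ Fin l) ℝ ×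
      Matrix (Fin k) (Fin m) ℝ => p.1 * emb l p.2 :=
    continuous_fst.matrix_mul (emb_continuous.comp continuous_snd)
  have hf0 : AEStronglyMeasurable (fun y => f (x + y)) volume :=
    hfloc.aestronglyMeasurable.comp_measurePreserving (measurePreserving_add_left volume x)
  have hac : Measure.map (fun p : Matrix (Fin k ⊕ Fin l) (Fin k ⊕ Fin l) ℝ ×
        Matrix (Fin k) (Fin m) ℝ => p.1 * emb l p.2) (μ.prod volume) ≪ volume := by
    rw [hmap]
    exact (Measure.smul_absolutelyContinuous).trans (withDensity_absolutelyContinuous _ _)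
  have hf1 := hf0.mono_ac hac
  have hf2 : AEStronglyMeasurable (fun p : Matrix (Fin k ⊕ Fin l) (Fin k ⊕ Fin l) ℝ ×
      Matrix (Fin k) (Fin m) ℝ => f (x + p.1 * emb l p.2)) (μ.prod volume) :=
    hf1.comp_measurable hc.measurable
  have hfint : Integrable (fun p : Matrix (Fin k ⊕ Fin l) (Fin k ⊕ Fin l) ℝ ×
      Matrix (Fin k) (Fin m) ℝ => f (x + p.1 * emb l p.2)) (μ.prod volume) :=
    (integrable_norm_iff hf2).1 habs
  have e1 : (∫ γ, (∫ u : Matrix (Fin k) (Fin m) ℝ,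
            f (γ * Matrix.fromRows u ((xi0 k l)ᵀ * γᵀ * x))) ∂μ) =
      ∫ γ, (∫ u : Matrix (Fin k) (Fin m) ℝ, f (x + γ * emb l u)) ∂μ := by
    apply integral_congr_ae
    filter_upwards [hμso] with γ hγ
    rw [← integral_add_right_eq_self _ ((γᵀ * x).toRows₁)]
    congr 1
    funext u
    rw [decomp γ hγ.1]
  have e2 := integral_prod (fun p : Matrix (Fin k ⊕ Fin l) (Fin k ⊕ Fin l) ℝ ×
      Matrix (Fin k) (Fin m) ℝ => f (x + p.1 * emb l p.2)) hfint
  have e3 := integral_map (μ := μ.prod volume) hc.measurable.aemeasurable hf1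
  rw [e1, ← e2, ← e3, hmap, integral_smul_measure,
    integral_withDensity_eq_integral_toReal_smul (w_measurable _)
      (Filter.Eventually.of_forall fun y => (w_ne_top _ y).lt_top),
    ENNReal.toReal_ofReal (cst_pos hkm).le, smul_eq_mul]
  congr 2
  funext y
  rw [w, ENNReal.toReal_ofReal (by positivity), smul_eq_mul, mul_comm]

end final

end Fuglede

/-- generalized Fuglede formula, case `k ≥ m`: for `f` locally integrable
on `M_{n,m}` (`n = k + l`) with `∫_{SO(n)}∫_{M_{k,m}} |f(x + γ[u;0])| du dγ < ∞` and
`k ≥ m`, one has `c (f̂)ˇ(x) = (I^k f)(x)`, where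
`(I^k f)(x) = γ_{n,m}(k)⁻¹ ∫ f(x-y) det(y'y)^{(k-n)/2} dy`,
`c = 2^{-km} π^{-km/2} Γ_m((n-k)/2)/Γ_m(n/2)`,
`γ_{n,m}(k) = 2^{km} π^{nm/2} Γ_m(k/2)/Γ_m((n-k)/2)`, and the dual Radon transform
`(f̂)ˇ(x) = ∫_{SO(n)} f̂(γξ₀, ξ₀'γ'x) dγ` is the mean over the normalized invariant
(probability) measure `μ` on `SO(n)`. -/
theorem fuglede_formula (k l m : ℕ) (hm : 0 < m) (hl : 0 < l) (hkm : m ≤ k)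
    (μ : Measure (Matrix (Fin k ⊕ Fin l) (Fin k ⊕ Fin l) ℝ)) [IsProbabilityMeasure μ]
    (hμso : ∀ᵐ γ ∂μ, γᵀ * γ = 1 ∧ γ.det = 1)
    (hμinv : ∀ ρ : Matrix (Fin k ⊕ Fin l) (Fin k ⊕ Fin l) ℝ, ρᵀ * ρ = 1 → ρ.det = 1 →
      MeasurePreserving (fun γ => ρ * γ) μ μ)
    (f : Matrix (Fin k ⊕ Fin l) (Fin m) ℝ → ℝ) (hfloc : LocallyIntegrable f)
    (x : Matrix (Fin k ⊕ Fin l) (Fin m) ℝ)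
    (habs : Integrable
      (fun p : Matrix (Fin k ⊕ Fin l) (Fin k ⊕ Fin l) ℝ × Matrix (Fin k) (Fin m) ℝ =>
        |f (x + p.1 * Matrix.fromRows p.2 (0 : Matrix (Fin l) (Fin m) ℝ))|)
      (μ.prod volume)) :
    ((2 : ℝ) ^ (k * m) * Real.pi ^ ((k * m : ℝ) / 2))⁻¹ *
        (SiegelGammaR m (((k + l : ℝ) - k) / 2) / SiegelGammaR m ((k + l : ℝ) / 2)) *
        (∫ γ, (∫ u : Matrix (Fin k) (Fin m) ℝ,
            f (γ * Matrix.fromRows u ((xi0 k l)ᵀ * γᵀ * x))) ∂μ) =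
      ((2 : ℝ) ^ (k * m) * Real.pi ^ (((k + l) * m : ℝ) / 2) *
          SiegelGammaR m ((k : ℝ) / 2) / SiegelGammaR m (((k + l : ℝ) - k) / 2))⁻¹ *
        ∫ y : Matrix (Fin k ⊕ Fin l) (Fin m) ℝ,
          f (x - y) * ((yᵀ * y).det) ^ (((k : ℝ) - (k + l)) / 2) := by
  have hkm' : (m : ℝ) ≤ k := by exact_mod_cast hkm
  have hl0 : (0 : ℝ) ≤ l := Nat.cast_nonneg _
  have h1 : 0 < SiegelGammaR m ((k : ℝ) / 2) := Fuglede.siegel_pos (by linarith)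
  have h2 : 0 < SiegelGammaR m (((k : ℝ) + l) / 2) := Fuglede.siegel_pos (by linarith)
  rw [Fuglede.final_left hl hkm hμso hμinv f hfloc x habs, Fuglede.final_right, Fuglede.cst]
  have e1 : Real.pi ^ ((((k : ℝ) + l) * m) / 2) =
      Real.pi ^ (((k : ℝ) * m) / 2) * Real.pi ^ (((l : ℝ) * m) / 2) := by
    rw [← Real.rpow_add Real.pi_pos]; congr 1; ring
  have e2 : Real.pi ^ (-((l : ℝ) * m) / 2) = (Real.pi ^ (((l : ℝ) * m) / 2))⁻¹ := by
    rw [← Real.rpow_neg Real.pi_pos.le]; congr 1; ring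
  rw [e1, e2]
  have p1 : 0 < Real.pi ^ (((k : ℝ) * m) / 2) := by positivity
  have p2 : 0 < Real.pi ^ (((l : ℝ) * m) / 2) := by positivity
  generalize Real.pi ^ (((k : ℝ) * m) / 2) = a at *
  generalize Real.pi ^ (((l : ℝ) * m) / 2) = b at *
  generalize SiegelGammaR m (((k : ℝ) + l) / 2) = S2 at *
  generalize SiegelGammaR m ((k : ℝ) / 2) = S1 at *
  generalize SiegelGammaR m (((k : ℝ) + l - k) / 2) = S0
  generalize (∫ y : Matrix (Fin k ⊕ Fin l) (Fin m) ℝ,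
          f (x + y) * √((yᵀ * y).det) ^ ((k : ℝ) - (k + l))) = J
  rw [inv_div]
  field_simp
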